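/- The simplification relation ⟹ on freshness environments is confluent and terminating; consequently every freshness environment ∇ has a unique ⟹-normal form. -/

import Mathlib

universe u v w y


/-- Raw terms over a nominal signature: variables, atoms, moderated terms (delayed
renamings), atom abstractions, tuples and function-symbol applications. -/
inductive Raw (𝔸 : Type u) (V : Type v) (F : Type w) : Type (max u v w) where
  | var : V → Raw 𝔸 V F
  | atom : 𝔸 → Raw 𝔸 V F
  | mod : Raw 𝔸 V F → (𝔸 → 𝔸) → Raw 𝔸 V F
  | abs : 𝔸 → Raw 𝔸 V F → Raw 𝔸 V F
  | tuple : List (Raw 𝔸 V F) → Raw 𝔸 V F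
  | app : F → Raw 𝔸 V F → Raw 𝔸 V F

variable {𝔸 : Type u} {V : Type v} {F : Type w}

mutual
  /-- The action of a renaming on a raw term, `t{ρ}`. -/
  def Raw.ren : Raw 𝔸 V F → (𝔸 → 𝔸) → Raw 𝔸 V F
    | .var x, _ => .var x
    | .atom a, ρ => .atom (ρ a)
    | .mod t ρ₁, ρ => .mod t (ρ ∘ ρ₁)
    | .abs a t, ρ => .abs (ρ a) (t.ren ρ)
    | .tuple ts, ρ => .tuple (Raw.renList ts ρ)
    | .app f t, ρ => .app f (t.ren ρ)
  def Raw.renList : List (Raw 𝔸 V F) → (𝔸 → 𝔸) → List (Raw 𝔸 V F)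
    | [], _ => []
    | t :: ts, ρ => t.ren ρ :: Raw.renList ts ρ
end

mutual
  /-- The action of a permutation on a raw term, `π · t`. -/
  def Raw.perm : Raw 𝔸 V F → Equiv.Perm 𝔸 → Raw 𝔸 V F
    | .var x, _ => .var x
    | .atom a, π => .atom (π a)
    | .mod t ρ, π => .mod (t.perm π) (π ∘ ρ ∘ π.symm)
    | .abs a t, π => .abs (π a) (t.perm π)
    | .tuple ts, π => .tuple (Raw.permList ts π)
    | .app f t, π => .app f (t.perm π)
  def Raw.permList : List (Raw 𝔸 V F) → Equiv.Perm 𝔸 → List (Raw 𝔸 V F)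
    | [], _ => []
    | t :: ts, π => t.perm π :: Raw.permList ts π
end

mutual
  /-- The set of variables occurring in a raw term. -/
  def Raw.vars : Raw 𝔸 V F → Set V
    | .var x => {x}
    | .atom _ => ∅
    | .mod t _ => t.vars
    | .abs _ t => t.vars
    | .tuple ts => Raw.varsList ts
    | .app _ t => t.vars
  def Raw.varsList : List (Raw 𝔸 V F) → Set V
    | [] => ∅
    | t :: ts => t.vars ∪ Raw.varsList ts
end

/-- The support of a renaming. -/
def renSupp (ρ : 𝔸 → 𝔸) : Set 𝔸 := {a | ρ a ≠ a} ∪ ρ '' {a | ρ a ≠ a}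

mutual
  /-- The support of a raw term. -/
  def Raw.supp : Raw 𝔸 V F → Set 𝔸
    | .var _ => ∅
    | .atom a => {a}
    | .mod t ρ => t.supp ∪ renSupp ρ
    | .abs a t => {a} ∪ t.supp
    | .tuple ts => Raw.suppList ts
    | .app _ t => t.supp
  def Raw.suppList : List (Raw 𝔸 V F) → Set 𝔸
    | [] => ∅
    | t :: ts => t.supp ∪ Raw.suppList ts
end

mutual
  /-- The size of a raw term. -/
  def Raw.size : Raw 𝔸 V F → ℕ
    | .var _ => 1
    | .atom _ => 1
    | .mod t _ => t.size + 1
    | .abs _ t => t.size + 1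
    | .tuple ts => Raw.sizeList ts + 1
    | .app _ t => t.size + 1
  def Raw.sizeList : List (Raw 𝔸 V F) → ℕ
    | [] => 0
    | t :: ts => t.size + Raw.sizeList ts + 1
end

mutual
  theorem Raw.size_ren : ∀ (t : Raw 𝔸 V F) (ρ : 𝔸 → 𝔸), (t.ren ρ).size = t.size
    | .var _, _ => rfl
    | .atom _, _ => rfl
    | .mod _ _, _ => rfl
    | .abs a t, ρ => by simp only [Raw.ren, Raw.size, Raw.size_ren t ρ]
    | .tuple ts, ρ => by simp only [Raw.ren, Raw.size, Raw.sizeList_renList ts ρ]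
    | .app f t, ρ => by simp only [Raw.ren, Raw.size, Raw.size_ren t ρ]
  theorem Raw.sizeList_renList :
      ∀ (ts : List (Raw 𝔸 V F)) (ρ : 𝔸 → 𝔸), Raw.sizeList (Raw.renList ts ρ) = Raw.sizeList ts
    | [], _ => rfl
    | t :: ts, ρ => by
        simp only [Raw.renList, Raw.sizeList, Raw.size_ren t ρ, Raw.sizeList_renList ts ρ]
end

mutual
  /-- The set of free atoms of a raw term. -/
  def Raw.fa : Raw 𝔸 V F → Set 𝔸
    | .var _ => ∅
    | .atom a => {a}
    | .mod t ρ => (t.ren ρ).fa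
    | .abs a t => t.fa \ {a}
    | .tuple ts => Raw.faList ts
    | .app _ t => t.fa
  termination_by t => t.size
  decreasing_by all_goals (simp [Raw.size, Raw.sizeList, Raw.size_ren] <;> omega)
  def Raw.faList : List (Raw 𝔸 V F) → Set 𝔸
    | [] => ∅
    | t :: ts => t.fa ∪ Raw.faList ts
  termination_by ts => Raw.sizeList ts
  decreasing_by all_goals (simp [Raw.size, Raw.sizeList, Raw.size_ren] <;> omega)
end

mutual
  /-- Extension of a substitution to raw terms. -/
  def Raw.subst : Raw 𝔸 V F → (V → Raw 𝔸 V F) → Raw 𝔸 V F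
    | .var x, φ => φ x
    | .atom a, _ => .atom a
    | .mod t ρ, φ => .mod (t.subst φ) ρ
    | .abs a t, φ => .abs a (t.subst φ)
    | .tuple ts, φ => .tuple (Raw.substList ts φ)
    | .app f t, φ => .app f (t.subst φ)
  def Raw.substList : List (Raw 𝔸 V F) → (V → Raw 𝔸 V F) → List (Raw 𝔸 V F)
    | [], _ => []
    | t :: ts, φ => t.subst φ :: Raw.substList ts φ
end

/-- A freshness assertion `a ⋦ t`. -/
abbrev Assn (𝔸 : Type u) (V : Type v) (F : Type w) := 𝔸 × Raw 𝔸 V F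

/-- One simplification step on a single freshness assertion, producing the set of
assertions that replaces it. -/
inductive AStep {𝔸 : Type u} {V : Type v} {F : Type w} :
    Assn 𝔸 V F → Set (Assn 𝔸 V F) → Prop where
  | atom {a b : 𝔸} : a ≠ b → AStep (a, .atom b) ∅
  | modAtom {a b : 𝔸} {ρ : 𝔸 → 𝔸} :
      AStep (a, .mod (.atom b) ρ) {(a, .atom (ρ b))}
  | modMod {a : 𝔸} {t : Raw 𝔸 V F} {ρ₁ ρ : 𝔸 → 𝔸} :
      AStep (a, .mod (.mod t ρ₁) ρ) {(a, .mod t (ρ ∘ ρ₁))}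
  | modAbs {a b : 𝔸} {t : Raw 𝔸 V F} {ρ : 𝔸 → 𝔸} :
      AStep (a, .mod (.abs b t) ρ) {(a, .abs (ρ b) (.mod t ρ))}
  | modTuple {a : 𝔸} {ts : List (Raw 𝔸 V F)} {ρ : 𝔸 → 𝔸} :
      AStep (a, .mod (.tuple ts) ρ) {e | ∃ t ∈ ts, e = (a, .mod t ρ)}
  | modApp {a : 𝔸} {f : F} {t : Raw 𝔸 V F} {ρ : 𝔸 → 𝔸} :
      AStep (a, .mod (.app f t) ρ) {(a, .mod t ρ)}
  | absNe {a b : 𝔸} {t : Raw 𝔸 V F} : a ≠ b → AStep (a, .abs b t) {(a, t)}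
  | absEq {a : 𝔸} {t : Raw 𝔸 V F} : AStep (a, .abs a t) ∅
  | tuple {a : 𝔸} {ts : List (Raw 𝔸 V F)} :
      AStep (a, .tuple ts) {e | ∃ t ∈ ts, e = (a, t)}
  | app {a : 𝔸} {f : F} {t : Raw 𝔸 V F} : AStep (a, .app f t) {(a, t)}

/-- Simplification of freshness environments: pick an assertion of the
environment and replace it by the result of one simplification step on it. -/
def SimpStep {𝔸 : Type u} {V : Type v} {F : Type w}
    (Γ₁ Γ₂ : Set (Assn 𝔸 V F)) : Prop :=
  ∃ e E, e ∈ Γ₁ ∧ AStep e E ∧ Γ₂ = (Γ₁ \ {e}) ∪ E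

/-!
STATEMENT 9: The simplification relation ⟹ on freshness environments is
confluent and terminating; consequently every freshness environment Γ has a
unique ⟹-normal form.
-/


mutual
  /-- Termination weight of a raw term. -/
  def Raw.wt : Raw 𝔸 V F → ℕ
    | .var _ => 1
    | .atom _ => 1
    | .mod t _ => 2 * t.wt
    | .abs _ t => t.wt + 1
    | .tuple ts => Raw.wtList ts + 1
    | .app _ t => t.wt + 1
  def Raw.wtList : List (Raw 𝔸 V F) → ℕ
    | [] => 0
    | t :: ts => t.wt + Raw.wtList ts
end

theorem wt_list_sum (a : 𝔸) : ∀ ts : List (Raw 𝔸 V F),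
    ((ts.map (fun t => ((a, t) : Assn 𝔸 V F))).map (fun e => e.2.wt)).sum = Raw.wtList ts
  | [] => rfl
  | t :: ts => by
      have := wt_list_sum a ts
      simp only [List.map_cons, List.sum_cons, Raw.wtList, this]

theorem wt_list_sum_mod (a : 𝔸) (ρ : 𝔸 → 𝔸) : ∀ ts : List (Raw 𝔸 V F),
    ((ts.map (fun t => ((a, .mod t ρ) : Assn 𝔸 V F))).map (fun e => e.2.wt)).sum
      = 2 * Raw.wtList ts
  | [] => rfl
  | t :: ts => by
      have := wt_list_sum_mod a ρ ts
      simp only [List.map_cons, List.sum_cons, Raw.wtList, this, Raw.wt]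
      ring

theorem AStep.list {e : Assn 𝔸 V F} {E : Set (Assn 𝔸 V F)} (h : AStep e E) :
    ∃ l : List (Assn 𝔸 V F), E = {x | x ∈ l} ∧ (l.map (fun e => e.2.wt)).sum < e.2.wt := by
  cases h with
  | atom h => exact ⟨[], by simp, by simp [Raw.wt]⟩
  | modAtom => exact ⟨[_], by ext x; simp; rfl, by simp [Raw.wt]⟩
  | @modMod a t ρ₁ ρ =>
    refine ⟨[_], by ext x; simp; rfl, ?_⟩
    have : 0 < t.wt := by
      clear * -
      induction t using Raw.rec (motive_2 := fun _ => True) <;> simp_all [Raw.wt]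
    simp [Raw.wt]; omega
  | modAbs => exact ⟨[_], by ext x; simp; rfl, by simp [Raw.wt]; omega⟩
  | @modTuple a ts ρ =>
    refine ⟨ts.map (fun t => (a, .mod t ρ)), ?_, ?_⟩
    · ext x; simp [eq_comm]
    · rw [wt_list_sum_mod]; simp only [Raw.wt]; omega
  | modApp => exact ⟨[_], by ext x; simp; rfl, by simp [Raw.wt]⟩
  | absNe h => exact ⟨[_], by ext x; simp; rfl, by simp [Raw.wt]⟩
  | absEq => exact ⟨[], by simp, by simp [Raw.wt]⟩
  | @tuple a ts =>
    refine ⟨ts.map (fun t => (a, t)), ?_, ?_⟩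
    · ext x; simp [eq_comm]
    · rw [wt_list_sum]; simp only [Raw.wt]; omega
  | app => exact ⟨[_], by ext x; simp; rfl, by simp [Raw.wt]⟩

theorem AStep.det {e : Assn 𝔸 V F} {E E' : Set (Assn 𝔸 V F)} (h : AStep e E)
    (h' : AStep e E') : E = E' := by
  cases h <;> cases h' <;> first | rfl | contradiction

theorem SimpStep.finite {Γ Γ' : Set (Assn 𝔸 V F)} (h : SimpStep Γ Γ') (hf : Γ.Finite) :
    Γ'.Finite := by
  obtain ⟨e, E, he, hE, rfl⟩ := h
  obtain ⟨l, rfl, -⟩ := hE.list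
  exact (hf.subset Set.diff_subset).union (List.finite_toSet l)

theorem SimpStep.wf :
    WellFounded (fun x y : {s : Set (Assn 𝔸 V F) // s.Finite} => SimpStep y.val x.val) := by
  classical
  refine Subrelation.wf (r := InvImage (· < ·)
    (fun x : {s : Set (Assn 𝔸 V F) // s.Finite} => ∑ e ∈ x.2.toFinset, e.2.wt)) ?_
    (InvImage.wf _ wellFounded_lt)
  rintro ⟨Γ', hf'⟩ ⟨Γ, hf⟩ ⟨e, E, he, hE, h⟩
  obtain ⟨l, rfl, hl⟩ := hE.list
  simp only [InvImage]
  dsimp only at h he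
  have h1 : hf'.toFinset = (hf.toFinset.erase e) ∪ l.toFinset := by
    ext x; simp [h, and_comm]
  have h2 : ∑ x ∈ l.toFinset, x.2.wt ≤ (l.map (fun e => e.2.wt)).sum := by
    clear * -
    induction l with
    | nil => simp
    | cons a l ih =>
      rw [List.toFinset_cons, List.map_cons, List.sum_cons]
      by_cases ha : a ∈ l.toFinset
      · rw [Finset.insert_eq_of_mem ha]; omega
      · rw [Finset.sum_insert ha]; omega
  have h3 := Finset.add_sum_erase hf.toFinset (fun x => x.2.wt) ((Set.Finite.mem_toFinset hf).2 he)
  have h4 := Finset.sum_union_inter (s₁ := hf.toFinset.erase e) (s₂ := l.toFinset)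
    (f := fun x => x.2.wt)
  rw [h1]
  omega

/-- One assertion is a direct descendant of another. -/
def Child (e e' : Assn 𝔸 V F) : Prop := ∃ E, AStep e E ∧ e' ∈ E

/-- The irreducible assertions reachable from an environment. -/
def NF (Γ : Set (Assn 𝔸 V F)) : Set (Assn 𝔸 V F) :=
  {e' | (∀ E, ¬ AStep e' E) ∧ ∃ e ∈ Γ, Relation.ReflTransGen Child e e'}

theorem NF_step {Γ Γ' : Set (Assn 𝔸 V F)} (h : SimpStep Γ Γ') : NF Γ = NF Γ' := by
  obtain ⟨e, E, he, hE, rfl⟩ := h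
  ext x
  refine and_congr_right fun hx => ⟨?_, ?_⟩
  · rintro ⟨d, hd, hr⟩
    by_cases hde : d = e
    · subst hde
      rcases hr.cases_head with rfl | ⟨c, ⟨E', hE', hc⟩, hr⟩
      · exact absurd hE (hx E)
      · exact ⟨c, Or.inr (hE.det hE' ▸ hc), hr⟩
    · exact ⟨d, Or.inl ⟨hd, hde⟩, hr⟩
  · rintro ⟨d, hd | hd, hr⟩
    · exact ⟨d, hd.1, hr⟩
    · exact ⟨e, he, hr.head ⟨E, hE, hd⟩⟩

theorem NF_steps {Γ Γ' : Set (Assn 𝔸 V F)} (h : Relation.ReflTransGen SimpStep Γ Γ') :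
    NF Γ = NF Γ' := by
  induction h with
  | refl => rfl
  | tail _ h ih => rw [ih, NF_step h]

theorem NF_normal {Γ : Set (Assn 𝔸 V F)} (h : ∀ Γ', ¬ SimpStep Γ Γ') : NF Γ = Γ := by
  have hi : ∀ e ∈ Γ, ∀ E, ¬ AStep e E := fun e he E hE => h _ ⟨e, E, he, hE, rfl⟩
  ext x
  constructor
  · rintro ⟨-, e, he, hr⟩
    rcases hr.cases_head with rfl | ⟨c, ⟨E', hE', hc⟩, hr⟩
    · exact he
    · exact absurd hE' (hi e he E')
  · exact fun hx => ⟨hi x hx, x, hx, .refl⟩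

theorem exists_normal (Γ : {s : Set (Assn 𝔸 V F) // s.Finite}) :
    ∃ Γ', Relation.ReflTransGen SimpStep Γ.1 Γ' ∧ ∀ Γ'', ¬ SimpStep Γ' Γ'' := by
  induction Γ using SimpStep.wf.induction with
  | _ Γ ih =>
    by_cases h : ∃ Γ', SimpStep Γ.1 Γ'
    · obtain ⟨Γ', h⟩ := h
      obtain ⟨Δ, h1, h2⟩ := ih ⟨Γ', h.finite Γ.2⟩ h
      exact ⟨Δ, h1.head h, h2⟩
    · exact ⟨Γ.1, .refl, fun Γ'' h' => h ⟨_, h'⟩⟩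

theorem steps_finite {Γ Γ' : Set (Assn 𝔸 V F)} (h : Relation.ReflTransGen SimpStep Γ Γ')
    (hf : Γ.Finite) : Γ'.Finite := by
  induction h with
  | refl => exact hf
  | tail _ h ih => exact h.finite ih

theorem steps_NF {Γ : Set (Assn 𝔸 V F)} (hf : Γ.Finite) :
    Relation.ReflTransGen SimpStep Γ (NF Γ) ∧ ∀ Γ'', ¬ SimpStep (NF Γ) Γ'' := by
  obtain ⟨Δ, h1, h2⟩ := exists_normal ⟨Γ, hf⟩
  have : NF Γ = Δ := (NF_steps h1).trans (NF_normal h2)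
  rw [this]
  exact ⟨h1, h2⟩

theorem stmt9 {𝔸 : Type u} {V : Type v} {F : Type w} :
    (∀ Γ₁ Γ₂ Γ₃ : Set (Assn 𝔸 V F), Γ₁.Finite →
      Relation.ReflTransGen SimpStep Γ₁ Γ₂ → Relation.ReflTransGen SimpStep Γ₁ Γ₃ →
      ∃ Γ₄, Relation.ReflTransGen SimpStep Γ₂ Γ₄ ∧ Relation.ReflTransGen SimpStep Γ₃ Γ₄) ∧
    (WellFounded (fun x y : {s : Set (Assn 𝔸 V F) // s.Finite} => SimpStep y.val x.val)) ∧
    (∀ Γ : Set (Assn 𝔸 V F), Γ.Finite →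
      ∃! Γ' : Set (Assn 𝔸 V F),
        Relation.ReflTransGen SimpStep Γ Γ' ∧ ∀ Γ'', ¬ SimpStep Γ' Γ'') := by
  refine ⟨?_, SimpStep.wf, ?_⟩
  · intro Γ₁ Γ₂ Γ₃ hf h2 h3
    refine ⟨NF Γ₁, ?_, ?_⟩
    · rw [NF_steps h2]; exact (steps_NF (steps_finite h2 hf)).1
    · rw [NF_steps h3]; exact (steps_NF (steps_finite h3 hf)).1
  · intro Γ hf
    refine ⟨NF Γ, steps_NF hf, ?_⟩
    rintro Δ ⟨h1, h2⟩
    exact ((NF_steps h1).trans (NF_normal h2)).symm
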